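/- arXiv:2308.02747 — 5 statements merged into one kernel-verified Lean document; each statement's English description precedes it below -/
import Mathlib

section
/- Let σ > 0, let Σ₀ be an n×n real positive definite matrix, let x₁, x₂, … be vectors in ℝⁿ, and define the covariance recursion Σ_t := K(Σ_{t−1}, x_t, σ) for t ≥ 1. Then for every t ≥ 0, the trace of the precision matrix satisfies tr(Σ_t⁻¹) = tr(Σ₀⁻¹) + (1/σ) ∑_{s=1}^{t} ‖x_s‖², where ‖·‖ is the Euclidean norm. -/
open Matrix

/-- The Kalman covariance update `K(Σ, x, σ) = Σ − (Σ x xᵀ Σ)/(xᵀ Σ x + σ)`. -/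
noncomputable def kalmanUpdate {n : ℕ} (S : Matrix (Fin n) (Fin n) ℝ) (x : Fin n → ℝ)
    (σ : ℝ) : Matrix (Fin n) (Fin n) ℝ :=
  S - (x ⬝ᵥ (S *ᵥ x) + σ)⁻¹ • (S * vecMulVec x x * S)

theorem kalman_mul_aux {n : ℕ} (S : Matrix (Fin n) (Fin n) ℝ) (hS : S.PosDef) (x : Fin n → ℝ)
    (σ : ℝ) (hσ : 0 < σ) :
    kalmanUpdate S x σ * (S⁻¹ + σ⁻¹ • vecMulVec x x) = 1 := by
  have hq : 0 ≤ x ⬝ᵥ (S *ᵥ x) := by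
    simpa using hS.posSemidef.dotProduct_mulVec_nonneg x
  have hdet : IsUnit S.det := hS.det_pos.ne'.isUnit
  have hV : vecMulVec x x * S * vecMulVec x x = (x ⬝ᵥ (S *ᵥ x)) • vecMulVec x x := by
    rw [Matrix.mul_assoc, Matrix.mul_vecMulVec, Matrix.vecMulVec_mul_vecMulVec]
    ext i j
    simp [vecMulVec_apply]
    try ring
  unfold kalmanUpdate
  generalize x ⬝ᵥ (S *ᵥ x) = q at *
  generalize vecMulVec x x = V at *
  have h1 : S * V * S * S⁻¹ = S * V := by
    rw [Matrix.mul_assoc (S * V), Matrix.mul_nonsing_inv _ hdet, Matrix.mul_one]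
  have h2 : S * V * S * V = q • (S * V) := by
    rw [Matrix.mul_assoc S V S, Matrix.mul_assoc, hV, Matrix.mul_smul]
  rw [Matrix.sub_mul, Matrix.mul_add, Matrix.mul_nonsing_inv _ hdet, Matrix.smul_mul,
    Matrix.mul_add, h1, Matrix.mul_smul, Matrix.mul_smul, h2]
  have hne : q + σ ≠ 0 := by positivity
  have hs : σ ≠ 0 := hσ.ne'
  ext i j
  simp only [Matrix.sub_apply, Matrix.add_apply, Matrix.smul_apply, smul_eq_mul]
  field_simp
  ring

theorem kalman_step_aux {n : ℕ} (S : Matrix (Fin n) (Fin n) ℝ) (hS : S.PosDef) (x : Fin n → ℝ)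
    (σ : ℝ) (hσ : 0 < σ) :
    (kalmanUpdate S x σ).PosDef ∧
      (kalmanUpdate S x σ)⁻¹ = S⁻¹ + σ⁻¹ • vecMulVec x x := by
  have h := kalman_mul_aux S hS x σ hσ
  have hP : (S⁻¹ + σ⁻¹ • vecMulVec x x).PosDef := by
    refine hS.inv.add_posSemidef (Matrix.PosSemidef.smul ?_ (inv_nonneg.2 hσ.le))
    simpa using Matrix.posSemidef_vecMulVec_self_star x
  refine ⟨?_, Matrix.inv_eq_right_inv h⟩
  rw [← Matrix.inv_eq_left_inv h]
  exact hP.inv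

theorem covariance_recursion_trace_inv {n : ℕ} (σ : ℝ) (hσ : 0 < σ)
    (x : ℕ → Fin n → ℝ) (Sig : ℕ → Matrix (Fin n) (Fin n) ℝ)
    (h0 : (Sig 0).PosDef)
    (hrec : ∀ t : ℕ, 1 ≤ t → Sig t = kalmanUpdate (Sig (t - 1)) (x t) σ) :
    ∀ t : ℕ, ((Sig t)⁻¹).trace =
      ((Sig 0)⁻¹).trace +
        σ⁻¹ * ∑ s ∈ Finset.Icc 1 t, ‖(WithLp.equiv 2 (Fin n → ℝ)).symm (x s)‖ ^ 2 := by
  intro t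
  suffices H : (Sig t).PosDef ∧ ((Sig t)⁻¹).trace =
      ((Sig 0)⁻¹).trace +
        σ⁻¹ * ∑ s ∈ Finset.Icc 1 t, ‖(WithLp.equiv 2 (Fin n → ℝ)).symm (x s)‖ ^ 2 from H.2
  induction t with
  | zero => exact ⟨h0, by simp⟩
  | succ t ih =>
    have hr : Sig (t + 1) = kalmanUpdate (Sig t) (x (t + 1)) σ := hrec (t + 1) (by omega)
    obtain ⟨hp, hi⟩ := kalman_step_aux (Sig t) ih.1 (x (t + 1)) σ hσ
    rw [hr]
    refine ⟨hp, ?_⟩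
    rw [hi, Matrix.trace_add, ih.2, Finset.sum_Icc_succ_top (by omega), Matrix.trace_smul,
      Matrix.trace_vecMulVec, mul_add, add_assoc, EuclideanSpace.norm_sq_eq]
    simp [dotProduct, pow_two]
end

section
/- Let σ > 0, let n ≥ 1, fix a coordinate k ∈ {1,…,n}, and let e_k ∈ ℝⁿ be the k-th standard basis vector. Let θ* , θ̂₀ ∈ ℝⁿ and b ∈ ℝ, and set Σ₀ := I_n, y_t := θ*_k + b for every t ≥ 1 (labels with constant bias b under observation vector e_k). Define Σ_t := K(Σ_{t−1}, e_k, σ) and θ̂_t := θ̂_{t−1} + (Σ_{t−1} e_k/(e_kᵀ Σ_{t−1} e_k + σ))·(y_t − e_kᵀ θ̂_{t−1}) for t ≥ 1. Then for every t ≥ 0 the k-th coordinate of the estimator satisfies (θ̂_t)_k = ((θ̂₀)_k + (t/σ)(θ*_k + b))/(1 + t/σ), and hence (θ̂_t)_k converges to θ*_k + b as t → ∞, i.e., the estimator learns the biased value θ*_k + b rather than θ*_k. -/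
open Matrix

/-- with observation vector `e_k`, `Σ₀ = I`, and constantly biased labels
`y_t = θ*_k + b`, the Kalman mean recursion satisfies
`(θ̂_t)_k = ((θ̂₀)_k + (t/σ)(θ*_k + b))/(1 + t/σ)`, hence `(θ̂_t)_k → θ*_k + b`. -/
theorem biased_labels_converge_to_biased_value {n : ℕ} (σ : ℝ) (hσ : 0 < σ)
    (k : Fin n) (θstar θ0 : Fin n → ℝ) (b : ℝ)
    (y : ℕ → ℝ) (hy : ∀ t : ℕ, 1 ≤ t → y t = θstar k + b)
    (Sig : ℕ → Matrix (Fin n) (Fin n) ℝ) (θ : ℕ → Fin n → ℝ)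
    (hS0 : Sig 0 = 1) (hθ0 : θ 0 = θ0)
    (hS : ∀ t : ℕ, 1 ≤ t → Sig t = kalmanUpdate (Sig (t - 1)) (Pi.single k 1) σ)
    (hθ : ∀ t : ℕ, 1 ≤ t → θ t = θ (t - 1) +
      (y t - (Pi.single k 1 : Fin n → ℝ) ⬝ᵥ θ (t - 1)) •
        (((Pi.single k 1 : Fin n → ℝ) ⬝ᵥ (Sig (t - 1) *ᵥ Pi.single k 1) + σ)⁻¹ •
          (Sig (t - 1) *ᵥ Pi.single k 1))) :
    (∀ t : ℕ, θ t k = (θ0 k + ((t : ℝ) / σ) * (θstar k + b)) / (1 + (t : ℝ) / σ)) ∧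
      Filter.Tendsto (fun t : ℕ => θ t k) Filter.atTop (nhds (θstar k + b)) := by
  have hpos : ∀ t : ℕ, 0 < σ + (t : ℝ) := fun t => by positivity
  have hs : ∀ t : ℕ, Sig t k k = σ / (σ + t) := by
    intro t
    induction t with
    | zero => simp [hS0, hσ.ne']
    | succ t ih =>
      have h1 := hS (t + 1) (by omega)
      have h2 : (Sig t * vecMulVec (Pi.single k 1) (Pi.single k 1) * Sig t :
          Matrix (Fin n) (Fin n) ℝ) k k
          = Sig t k k * Sig t k k := by
        rw [mul_vecMulVec, vecMulVec_mul, vecMulVec_apply]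
        simp
      have hp := hpos t
      have hp' := hpos (t + 1)
      rw [h1, Nat.add_sub_cancel, kalmanUpdate, Matrix.sub_apply, Matrix.smul_apply, h2]
      simp only [mulVec_single_one, single_one_dotProduct, Matrix.col_apply, smul_eq_mul, ih]
      push_cast at hp' ⊢
      have h3 : σ / (σ + t) + σ = σ * (σ + (t + 1)) / (σ + t) := by
        field_simp
        ring
      rw [h3]
      field_simp
      ring
  have hmain : ∀ t : ℕ,
      θ t k = (θ0 k + ((t : ℝ) / σ) * (θstar k + b)) / (1 + (t : ℝ) / σ) := by
    intro t
    have key : θ t k = (σ * θ0 k + t * (θstar k + b)) / (σ + t) := by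
      induction t with
      | zero => simp [hθ0, hσ.ne']
      | succ t ih =>
        have h1 := congrFun (hθ (t + 1) (by omega)) k
        have hp := hpos t
        have hp' := hpos (t + 1)
        rw [Nat.add_sub_cancel, hy (t + 1) (by omega)] at h1
        simp only [mulVec_single_one, single_one_dotProduct, Matrix.col_apply, smul_eq_mul,
          Pi.add_apply, Pi.smul_apply, ih, hs] at h1
        rw [h1]
        push_cast at hp' ⊢
        have h3 : σ / (σ + t) + σ = σ * (σ + (t + 1)) / (σ + t) := by
          field_simp
          ring
        rw [h3]
        field_simp
        ring
    have hp := hpos t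
    have h4 : 1 + (t : ℝ) / σ = (σ + t) / σ := by field_simp
    rw [key, h4]
    field_simp
  refine ⟨hmain, ?_⟩
  have heq : (fun t : ℕ => θ t k)
      = fun t : ℕ => (θstar k + b) + σ * (θ0 k - (θstar k + b)) / (σ + t) := by
    funext t
    have hp := hpos t
    have h4 : 1 + (t : ℝ) / σ = (σ + t) / σ := by field_simp
    rw [hmain t, h4]
    field_simp
    ring
  rw [heq]
  have hlim : Filter.Tendsto (fun t : ℕ => σ * (θ0 k - (θstar k + b)) / (σ + (t : ℝ)))
      Filter.atTop (nhds 0) :=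
    (Filter.tendsto_atTop_add_const_left _ σ tendsto_natCast_atTop_atTop).const_div_atTop _
  simpa using hlim.const_add (θstar k + b)
end

section
/- Let A be an n×n real row stochastic matrix and x ∈ ℝⁿ. Then v(Ax) ≤ (1 − min_{1≤i,j≤n} ∑_{k=1}^{n} min(A_{ik}, A_{jk})) · v(x), where v(x) := max_i x_i − min_i x_i. -/
open Matrix

/-- The diameter `v(x) = max_i x_i − min_i x_i` of a vector `x ∈ ℝⁿ`. -/
noncomputable def vdiam {n : ℕ} [NeZero n] (x : Fin n → ℝ) : ℝ :=
  Finset.univ.sup' Finset.univ_nonempty x - Finset.univ.inf' Finset.univ_nonempty x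

/-- Seneta's contraction lemma: for a row stochastic matrix `A`,
`v(Ax) ≤ (1 − min_{i,j} ∑_k min(A_{ik}, A_{jk})) v(x)`. -/
theorem seneta_contraction {n : ℕ} [NeZero n] (A : Matrix (Fin n) (Fin n) ℝ)
    (hpos : ∀ i j, 0 ≤ A i j) (hrow : ∀ i, ∑ j, A i j = 1) (x : Fin n → ℝ) :
    vdiam (A *ᵥ x) ≤
      (1 - Finset.univ.inf' Finset.univ_nonempty
          (fun p : Fin n × Fin n => ∑ k, min (A p.1 k) (A p.2 k))) * vdiam x := by
  obtain ⟨i, -, hi⟩ := Finset.exists_mem_eq_sup' Finset.univ_nonempty (A *ᵥ x)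
  obtain ⟨j, -, hj⟩ := Finset.exists_mem_eq_inf' Finset.univ_nonempty (A *ᵥ x)
  have hL : vdiam (A *ᵥ x) = (A *ᵥ x) i - (A *ᵥ x) j := by
    unfold vdiam
    rw [hi, hj]
  rw [hL]
  have hmin := Finset.inf'_le (fun p : Fin n × Fin n => ∑ k, min (A p.1 k) (A p.2 k))
    (Finset.mem_univ (i, j))
  simp only at hmin
  have hM : ∀ k, x k ≤ Finset.univ.sup' Finset.univ_nonempty x :=
    fun k => Finset.le_sup' x (Finset.mem_univ k)
  have hm : ∀ k, Finset.univ.inf' Finset.univ_nonempty x ≤ x k :=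
    fun k => Finset.inf'_le x (Finset.mem_univ k)
  unfold vdiam
  generalize Finset.univ.sup' Finset.univ_nonempty x = M at *
  generalize Finset.univ.inf' Finset.univ_nonempty x = m at *
  generalize Finset.univ.inf' Finset.univ_nonempty
    (fun p : Fin n × Fin n => ∑ k, min (A p.1 k) (A p.2 k)) = t at *
  have h1 : ∑ k, (A i k - min (A i k) (A j k)) * x k
      ≤ ∑ k, (A i k - min (A i k) (A j k)) * M :=
    Finset.sum_le_sum fun k _ =>
      mul_le_mul_of_nonneg_left (hM k) (sub_nonneg.2 (min_le_left _ _))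
  have h2 : ∑ k, (A j k - min (A i k) (A j k)) * m
      ≤ ∑ k, (A j k - min (A i k) (A j k)) * x k :=
    Finset.sum_le_sum fun k _ =>
      mul_le_mul_of_nonneg_left (hm k) (sub_nonneg.2 (min_le_right _ _))
  rw [← Finset.sum_mul, Finset.sum_sub_distrib, hrow] at h1 h2
  simp only [sub_mul, Finset.sum_sub_distrib] at h1 h2
  have hmM : m ≤ M := (hm i).trans (hM i)
  have h3 := mul_le_mul_of_nonneg_right hmin (sub_nonneg.2 hmM)
  have e : ∀ l, (A *ᵥ x) l = ∑ k, A l k * x k := fun l => rfl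
  rw [e, e]
  linarith
end

section
/- Let A be an n×n real row stochastic matrix all of whose entries are at least δ for some δ ≥ 0, and let x ∈ ℝⁿ. Then v(Ax) ≤ (1 − nδ) · v(x), where v(x) := max_i x_i − min_i x_i. -/
open Matrix

/-- for a row stochastic matrix `A` all of whose entries are at least
`δ ≥ 0`, `v(Ax) ≤ (1 − nδ) v(x)`. -/
theorem row_stochastic_entrywise_contraction {n : ℕ} [NeZero n]
    (A : Matrix (Fin n) (Fin n) ℝ) (δ : ℝ) (hδ : 0 ≤ δ)
    (hent : ∀ i j, δ ≤ A i j) (hrow : ∀ i, ∑ j, A i j = 1) (x : Fin n → ℝ) :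
    vdiam (A *ᵥ x) ≤ (1 - (n : ℝ) * δ) * vdiam x := by
  have hs : ∀ i c, ∑ j, (A i j - δ) * c = (1 - (n : ℝ) * δ) * c := by
    intro i c
    rw [← Finset.sum_mul, Finset.sum_sub_distrib, hrow]
    simp
  have he : ∀ i, (A *ᵥ x) i = δ * ∑ j, x j + ∑ j, (A i j - δ) * x j := by
    intro i
    rw [Finset.mul_sum, ← Finset.sum_add_distrib]
    simp only [Matrix.mulVec, dotProduct]
    exact Finset.sum_congr rfl fun j _ => by ring
  unfold vdiam
  set M := Finset.univ.sup' Finset.univ_nonempty x with hM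
  set m := Finset.univ.inf' Finset.univ_nonempty x with hm
  have h1 : Finset.univ.sup' Finset.univ_nonempty (A *ᵥ x)
      ≤ δ * ∑ j, x j + (1 - (n : ℝ) * δ) * M := by
    refine Finset.sup'_le _ _ fun i _ => ?_
    rw [he, ← hs i M]
    gcongr with j
    · linarith [hent i j]
    · exact Finset.le_sup' x (Finset.mem_univ j)
  have h2 : δ * ∑ j, x j + (1 - (n : ℝ) * δ) * m
      ≤ Finset.univ.inf' Finset.univ_nonempty (A *ᵥ x) := by
    refine Finset.le_inf' _ _ fun i _ => ?_
    rw [he, ← hs i m]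
    gcongr with j
    · linarith [hent i j]
    · exact Finset.inf'_le x (Finset.mem_univ j)
  linarith
end

section
/- Let (A_t)_{t≥0} be a sequence of n×n real row stochastic matrices and let (δ_t)_{t≥0} be reals with 0 ≤ δ_t ≤ 1 such that for every t and all indices i, j, ∑_{k=1}^{n} min((A_t)_{ik}, (A_t)_{jk}) ≥ δ_t, and suppose ∑_{t=0}^{∞} δ_t = ∞. Let x₀ ∈ ℝⁿ and define x_{t+1} := A_t x_t. Then there exists a real number c with min_i (x₀)_i ≤ c ≤ max_i (x₀)_i such that x_t converges to c·𝟙 (the constant vector with all coordinates c) as t → ∞. -/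
open Matrix

/-- under the joint connectivity condition with `∑_t δ_t = ∞`, the
opinion dynamics `x_{t+1} = A_t x_t` driven by row stochastic matrices reaches
consensus: `x_t → c·𝟙` for some `c` between the smallest and largest coordinate of
`x₀`. -/
theorem opinion_dynamics_consensus {n : ℕ} [NeZero n]
    (A : ℕ → Matrix (Fin n) (Fin n) ℝ)
    (hpos : ∀ t i j, 0 ≤ A t i j) (hrow : ∀ t i, ∑ j, A t i j = 1)
    (δ : ℕ → ℝ) (hδ0 : ∀ t, 0 ≤ δ t) (hδ1 : ∀ t, δ t ≤ 1)
    (hconn : ∀ t i j, δ t ≤ ∑ k, min (A t i k) (A t j k))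
    (hdiv : Filter.Tendsto (fun T => ∑ t ∈ Finset.range T, δ t)
      Filter.atTop Filter.atTop)
    (x : ℕ → Fin n → ℝ) (hx : ∀ t, x (t + 1) = A t *ᵥ x t) :
    ∃ c : ℝ,
      Finset.univ.inf' Finset.univ_nonempty (x 0) ≤ c ∧
        c ≤ Finset.univ.sup' Finset.univ_nonempty (x 0) ∧
        Filter.Tendsto x Filter.atTop (nhds (fun _ => c)) := by
  set M : ℕ → ℝ := fun t => Finset.univ.sup' Finset.univ_nonempty (x t) with hM
  set m : ℕ → ℝ := fun t => Finset.univ.inf' Finset.univ_nonempty (x t) with hm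
  have hxM : ∀ t i, x t i ≤ M t := fun t i => Finset.le_sup' (x t) (Finset.mem_univ i)
  have hmx : ∀ t i, m t ≤ x t i := fun t i => Finset.inf'_le (x t) (Finset.mem_univ i)
  have hmM : ∀ t, m t ≤ M t := fun t => (hmx t 0).trans (hxM t 0)
  have hstep : ∀ t i, x (t + 1) i = ∑ k, A t i k * x t k := by
    intro t i
    rw [hx t]
    rfl
  have hMa : Antitone M := by
    refine antitone_nat_of_succ_le fun t => ?_
    refine Finset.sup'_le _ _ fun i _ => ?_
    rw [hstep]
    calc ∑ k, A t i k * x t k ≤ ∑ k, A t i k * M t :=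
          Finset.sum_le_sum fun k _ => mul_le_mul_of_nonneg_left (hxM t k) (hpos t i k)
      _ = M t := by rw [← Finset.sum_mul, hrow, one_mul]
  have hmm : Monotone m := by
    refine monotone_nat_of_le_succ fun t => ?_
    refine Finset.le_inf' _ _ fun i _ => ?_
    rw [hstep]
    calc m t = ∑ k, A t i k * m t := by rw [← Finset.sum_mul, hrow, one_mul]
      _ ≤ ∑ k, A t i k * x t k :=
          Finset.sum_le_sum fun k _ => mul_le_mul_of_nonneg_left (hmx t k) (hpos t i k)
  have hcontr : ∀ t, M (t + 1) - m (t + 1) ≤ (1 - δ t) * (M t - m t) := by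
    intro t
    obtain ⟨i, -, hi⟩ := Finset.exists_mem_eq_sup' Finset.univ_nonempty (x (t + 1))
    obtain ⟨j, -, hj⟩ := Finset.exists_mem_eq_inf' Finset.univ_nonempty (x (t + 1))
    have hi2 : M (t + 1) = x (t + 1) i := hi
    have hj2 : m (t + 1) = x (t + 1) j := hj
    rw [hi2, hj2, hstep, hstep]
    have h1 : ∑ k, (A t i k - min (A t i k) (A t j k)) * x t k
        ≤ ∑ k, (A t i k - min (A t i k) (A t j k)) * M t :=
      Finset.sum_le_sum fun k _ => mul_le_mul_of_nonneg_left (hxM t k)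
        (sub_nonneg.2 (min_le_left _ _))
    have h2 : ∑ k, (A t j k - min (A t i k) (A t j k)) * m t
        ≤ ∑ k, (A t j k - min (A t i k) (A t j k)) * x t k :=
      Finset.sum_le_sum fun k _ => mul_le_mul_of_nonneg_left (hmx t k)
        (sub_nonneg.2 (min_le_right _ _))
    rw [← Finset.sum_mul, Finset.sum_sub_distrib, hrow] at h1 h2
    simp only [sub_mul, Finset.sum_sub_distrib] at h1 h2
    have h3 := mul_le_mul_of_nonneg_right (hconn t i j) (sub_nonneg.2 (hmM t))
    linarith
  have hexp : ∀ T, M T - m T ≤ Real.exp (-∑ t ∈ Finset.range T, δ t) * (M 0 - m 0) := by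
    intro T
    induction T with
    | zero => simp
    | succ T ih =>
      refine (hcontr T).trans ?_
      rw [Finset.sum_range_succ, neg_add, Real.exp_add]
      have h1 : 1 - δ T ≤ Real.exp (-δ T) := by
        have := Real.add_one_le_exp (-δ T)
        linarith
      calc (1 - δ T) * (M T - m T)
          ≤ Real.exp (-δ T) * (Real.exp (-∑ t ∈ Finset.range T, δ t) * (M 0 - m 0)) :=
            mul_le_mul h1 ih (sub_nonneg.2 (hmM T)) (Real.exp_pos _).le
        _ = _ := by ring
  have hlim : Filter.Tendsto (fun T => M T - m T) Filter.atTop (nhds 0) := by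
    refine squeeze_zero (fun T => sub_nonneg.2 (hmM T)) hexp ?_
    have := (Real.tendsto_exp_neg_atTop_nhds_zero.comp hdiv).mul_const (M 0 - m 0)
    simpa using this
  have hcross : ∀ s t, m s ≤ M t := fun s t =>
    (hmm (le_max_left s t)).trans ((hmM _).trans (hMa (le_max_right s t)))
  have hbdd : BddAbove (Set.range m) := ⟨M 0, by rintro _ ⟨s, rfl⟩; exact hcross s 0⟩
  have hc1 : ∀ t, m t ≤ ⨆ s, m s := fun t => le_ciSup hbdd t
  have hc2 : ∀ t, ⨆ s, m s ≤ M t := fun t => ciSup_le fun s => hcross s t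
  refine ⟨⨆ s, m s, hc1 0, hc2 0, ?_⟩
  rw [tendsto_pi_nhds]
  intro i
  rw [tendsto_iff_dist_tendsto_zero]
  refine squeeze_zero (fun _ => dist_nonneg) (fun t => ?_) hlim
  rw [Real.dist_eq, abs_le]
  have := hc1 t
  have := hc2 t
  have := hxM t i
  have := hmx t i
  constructor <;> linarith
end
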